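/- Fix p ∈ (0,1), q := 1 − p, B > 0, δ ∈ (0,1), and fix a ν-Lipschitz twice differentiable function f : ℝ → ℝ with |f''| ≤ η and a twice continuously differentiable encoder u_enc : [−1,1] → ℝ satisfying u_enc(α_k) = x_k for all k = 1,…,K (with α_k, x_k fixed, independent of N). Consider, for each N, decoder points β_1 < ⋯ < β_N in (−1,1) with Δ_max/Δ_min ≤ B, a regularization parameter 0 < λ ≤ N^{−4}, i.i.d. Bernoulli(p) straggler indicators B_1,…,B_N with F := {n : B_n = 0}, and (on F ≠ ∅) the smoothing-spline minimizer u_dec for nodes {β_v : v ∈ F}, data f(u_enc(β_v)), and parameter λ. Then there exist a constant C > 0 and n_0 ∈ ℕ such that for all N > n_0, with probability at least 1 − δ, F ≠ ∅ and (1/K)·Σ_{k=1}^K (u_dec(α_k) − f(x_k))² ≤ C · (log_{1/p} N)³ / N³. -/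

import Mathlib

open MeasureTheory

/-- The Bernoulli measure on `Bool` giving probability `p` to `true` (straggler). -/
noncomputable def bernoulliMeasure (p : ℝ) : Measure Bool :=
  ENNReal.ofReal p • Measure.dirac true + ENNReal.ofReal (1 - p) • Measure.dirac false

/-- The law of `N` i.i.d. Bernoulli(p) straggler indicators. -/
noncomputable def stragglerMeasure (p : ℝ) (N : ℕ) : Measure (Fin N → Bool) :=
  Measure.pi fun _ => bernoulliMeasure p

/-- The set of non-straggler servers: those `n` with `B_n = 0` (i.e. `ω n = false`). -/
def nonStragglers {N : ℕ} (ω : Fin N → Bool) : Finset (Fin N) :=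
  Finset.univ.filter fun n => ω n = false

/-- Extension of decoder points `β_1 < ⋯ < β_N` (indexed here by `Fin N`, zero-based)
by the sentinels `β_0 := -1` and `β_{N+1} := 1`. -/
noncomputable def extNodes {N : ℕ} (β : Fin N → ℝ) : ℕ → ℝ := fun n =>
  if h : 1 ≤ n ∧ n ≤ N then β ⟨n - 1, by omega⟩ else if n = 0 then -1 else 1

/-- `Δ_max := max_{0 ≤ n ≤ N} (β_{n+1} − β_n)`. -/
noncomputable def dMax {N : ℕ} (β : Fin N → ℝ) : ℝ :=
  sSup ((fun n => extNodes β (n + 1) - extNodes β n) '' Set.Iic N)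

/-- `Δ_min := min_{1 ≤ n ≤ N−1} (β_{n+1} − β_n)`. -/
noncomputable def dMin {N : ℕ} (β : Fin N → ℝ) : ℝ :=
  sInf ((fun n => extNodes β (n + 1) - extNodes β n) '' Set.Icc 1 (N - 1))

/-- The smoothing-spline objective
`J(u) := (1/|F|)·Σ_{v∈F} (u(β_v) − y_v)² + λ·∫_{−1}^{1} (u''(t))² dt`. -/
noncomputable def splineLoss {N : ℕ} (F : Finset (Fin N)) (β y : Fin N → ℝ) (lam : ℝ)
    (u : ℝ → ℝ) : ℝ :=
  (1 / (F.card : ℝ)) * ∑ v ∈ F, (u (β v) - y v) ^ 2 +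
    lam * ∫ t in Set.Icc (-1 : ℝ) 1, (iteratedDerivWithin 2 u (Set.Icc (-1 : ℝ) 1) t) ^ 2

/-- Admissible competitors: twice continuously differentiable on `[−1,1]`
with square-integrable second derivative. -/
def SplineAdmissible (u : ℝ → ℝ) : Prop :=
  ContDiffOn ℝ 2 u (Set.Icc (-1 : ℝ) 1) ∧
    MeasureTheory.IntegrableOn
      (fun t => (iteratedDerivWithin 2 u (Set.Icc (-1 : ℝ) 1) t) ^ 2) (Set.Icc (-1 : ℝ) 1)

/-- `u` is a smoothing-spline minimizer for nodes `{β_v : v ∈ F}`, data `y_v`, parameter `λ`. -/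
def IsSmoothingSpline {N : ℕ} (F : Finset (Fin N)) (β y : Fin N → ℝ) (lam : ℝ)
    (u : ℝ → ℝ) : Prop :=
  SplineAdmissible u ∧ ∀ w, SplineAdmissible w → splineLoss F β y lam u ≤ splineLoss F β y lam w

/-- Steklov averaging: a `C¹` function with bounded first and second derivatives is uniformly
approximated by `C²` functions obeying the same derivative bounds. -/
theorem exists_contDiff_two_approx {f : ℝ → ℝ} {ν η : ℝ} (hν : 0 < ν)
    (hLip : ∀ a b : ℝ, |f a - f b| ≤ ν * |a - b|)
    (hf1 : ∀ t, DifferentiableAt ℝ f t) (hf2 : ∀ t, DifferentiableAt ℝ (deriv f) t)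
    (hfη : ∀ t, |deriv (deriv f) t| ≤ η) {ε : ℝ} (hε : 0 < ε) :
    ∃ g : ℝ → ℝ, ContDiff ℝ 2 g ∧ (∀ t, |g t - f t| ≤ ε) ∧ (∀ t, |deriv g t| ≤ ν) ∧
      ∀ t, |deriv (deriv g) t| ≤ η := by
  obtain ⟨h, hh, hνh⟩ : ∃ h : ℝ, 0 < h ∧ ν * h = ε := ⟨ε / ν, by positivity, by field_simp⟩
  have hfc : Continuous f := (show Differentiable ℝ f from hf1).continuous
  have hf'c : Continuous (deriv f) := (show Differentiable ℝ (deriv f) from hf2).continuous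
  set G : ℝ → ℝ := fun t => ∫ s in (0 : ℝ)..t, f s
  have hGd : ∀ t, HasDerivAt G (f t) t := fun t =>
    (hfc.integral_hasStrictDerivAt 0 t).hasDerivAt
  have hg1 : ∀ t, HasDerivAt (fun t => (G (t + h) - G t) / h) ((f (t + h) - f t) / h) t :=
    fun t => (((hGd (t + h)).comp_add_const t h).sub (hGd t)).div_const h
  have hg2 : ∀ t, HasDerivAt (fun t => (f (t + h) - f t) / h)
      ((deriv f (t + h) - deriv f t) / h) t :=
    fun t => ((((hf1 (t + h)).hasDerivAt).comp_add_const t h).sub (hf1 t).hasDerivAt).div_const h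
  have hd1 : deriv (fun t => (G (t + h) - G t) / h) = fun t => (f (t + h) - f t) / h :=
    funext fun t => (hg1 t).deriv
  have hd2 : deriv (fun t => (f (t + h) - f t) / h) =
      fun t => (deriv f (t + h) - deriv f t) / h :=
    funext fun t => (hg2 t).deriv
  refine ⟨fun t => (G (t + h) - G t) / h, ?_, fun t => ?_, fun t => ?_, fun t => ?_⟩
  · rw [show (2 : WithTop ℕ∞) = 1 + 1 by norm_num, contDiff_succ_iff_deriv]
    refine ⟨fun t => (hg1 t).differentiableAt, by simp, ?_⟩
    rw [hd1, contDiff_one_iff_deriv, hd2]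
    exact ⟨fun t => (hg2 t).differentiableAt, by fun_prop⟩
  · obtain ⟨c, hc, hce⟩ := exists_hasDerivAt_eq_slope G f (show t < t + h by linarith)
      (fun s _ => (hGd s).continuousAt.continuousWithinAt) (fun s _ => hGd s)
    rw [add_sub_cancel_left] at hce
    beta_reduce
    rw [← hce, ← hνh]
    refine (hLip c t).trans (mul_le_mul_of_nonneg_left ?_ hν.le)
    rw [abs_of_pos (by linarith [hc.1])]
    linarith [hc.2]
  · rw [hd1, abs_div, abs_of_pos hh, div_le_iff₀ hh]
    simpa [abs_of_pos hh] using hLip (t + h) t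
  · rw [hd1, hd2, abs_div, abs_of_pos hh, div_le_iff₀ hh]
    simpa [abs_of_pos hh] using Convex.norm_image_sub_le_of_norm_deriv_le
      (fun x _ => hf2 x) (fun x _ => hfη x) convex_univ (Set.mem_univ t) (Set.mem_univ (t + h))

theorem uniqueDiffOn_Icc_neg_one_one : UniqueDiffOn ℝ (Set.Icc (-1 : ℝ) 1) :=
  uniqueDiffOn_Icc (by norm_num)

theorem hasDerivWithinAt_of_contDiffOn_two {u : ℝ → ℝ}
    (hu : ContDiffOn ℝ 2 u (Set.Icc (-1 : ℝ) 1)) {t : ℝ} (ht : t ∈ Set.Icc (-1 : ℝ) 1) :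
    HasDerivWithinAt u (derivWithin u (Set.Icc (-1 : ℝ) 1) t) (Set.Icc (-1 : ℝ) 1) t :=
  (hu.differentiableOn (by norm_num) t ht).hasDerivWithinAt

theorem hasDerivWithinAt_derivWithin_of_contDiffOn_two {u : ℝ → ℝ}
    (hu : ContDiffOn ℝ 2 u (Set.Icc (-1 : ℝ) 1)) {t : ℝ} (ht : t ∈ Set.Icc (-1 : ℝ) 1) :
    HasDerivWithinAt (derivWithin u (Set.Icc (-1 : ℝ) 1))
      (iteratedDerivWithin 2 u (Set.Icc (-1 : ℝ) 1) t) (Set.Icc (-1 : ℝ) 1) t := by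
  have h := hu.differentiableOn_iteratedDerivWithin (m := 1) (by norm_num)
    uniqueDiffOn_Icc_neg_one_one t ht
  have h2 : iteratedDerivWithin 2 u (Set.Icc (-1 : ℝ) 1) t =
      derivWithin (iteratedDerivWithin 1 u (Set.Icc (-1 : ℝ) 1)) (Set.Icc (-1 : ℝ) 1) t := by
    rw [iteratedDerivWithin_succ]
  rw [h2, ← iteratedDerivWithin_one]
  exact h.hasDerivWithinAt

theorem continuousOn_iteratedDerivWithin_two {u : ℝ → ℝ}
    (hu : ContDiffOn ℝ 2 u (Set.Icc (-1 : ℝ) 1)) :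
    ContinuousOn (iteratedDerivWithin 2 u (Set.Icc (-1 : ℝ) 1)) (Set.Icc (-1 : ℝ) 1) :=
  hu.continuousOn_iteratedDerivWithin (by norm_num) uniqueDiffOn_Icc_neg_one_one

theorem iteratedDerivWithin_two_comp {g u : ℝ → ℝ} (hg : ContDiff ℝ 2 g)
    (hu : ContDiffOn ℝ 2 u (Set.Icc (-1 : ℝ) 1)) {t : ℝ} (ht : t ∈ Set.Icc (-1 : ℝ) 1) :
    iteratedDerivWithin 2 (g ∘ u) (Set.Icc (-1 : ℝ) 1) t =
      deriv (deriv g) (u t) * derivWithin u (Set.Icc (-1 : ℝ) 1) t ^ 2 +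
        deriv g (u t) * iteratedDerivWithin 2 u (Set.Icc (-1 : ℝ) 1) t := by
  have hg' : ContDiff ℝ 1 (deriv g) := by
    rw [show (2 : WithTop ℕ∞) = 1 + 1 by norm_num, contDiff_succ_iff_deriv] at hg
    exact hg.2.2
  have hgd : ∀ s, HasDerivAt g (deriv g s) s := fun s =>
    (hg.differentiable (by norm_num) s).hasDerivAt
  have hgd' : ∀ s, HasDerivAt (deriv g) (deriv (deriv g) s) s := fun s =>
    (hg'.differentiable (by norm_num) s).hasDerivAt
  have h1 : Set.EqOn (derivWithin (g ∘ u) (Set.Icc (-1 : ℝ) 1))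
      (fun s => deriv g (u s) * derivWithin u (Set.Icc (-1 : ℝ) 1) s) (Set.Icc (-1 : ℝ) 1) :=
    fun s hs => ((hgd (u s)).comp_hasDerivWithinAt s
      (hasDerivWithinAt_of_contDiffOn_two hu hs)).derivWithin (uniqueDiffOn_Icc_neg_one_one s hs)
  have h2 := ((hgd' (u t)).comp_hasDerivWithinAt t (hasDerivWithinAt_of_contDiffOn_two hu ht)).mul
    (hasDerivWithinAt_derivWithin_of_contDiffOn_two hu ht)
  rw [iteratedDerivWithin_succ, iteratedDerivWithin_one, derivWithin_congr h1 (h1 ht)]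
  refine (h2.derivWithin (uniqueDiffOn_Icc_neg_one_one t ht)).trans ?_
  simp only [Function.comp]
  ring

theorem sq_integral_le_mul_integral_sq {φ : ℝ → ℝ} {a b : ℝ} (hab : a < b)
    (hφ : ContinuousOn φ (Set.Icc a b)) :
    (∫ t in a..b, |φ t|) ^ 2 ≤ (b - a) * ∫ t in a..b, φ t ^ 2 := by
  rw [← Set.uIcc_of_le hab.le] at hφ
  have hba : 0 < b - a := sub_pos.2 hab
  have h1 : IntervalIntegrable (fun t => |φ t|) volume a b := hφ.abs.intervalIntegrable
  have h2 : IntervalIntegrable (fun t => φ t ^ 2) volume a b := (hφ.pow 2).intervalIntegrable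
  set I := ∫ t in a..b, |φ t|
  have hnn : 0 ≤ ∫ t in a..b, (|φ t| - I / (b - a)) ^ 2 :=
    intervalIntegral.integral_nonneg hab.le fun _ _ => sq_nonneg _
  have hexp : ∫ t in a..b, (|φ t| - I / (b - a)) ^ 2 =
      (∫ t in a..b, φ t ^ 2) - 2 * (I / (b - a)) * I + (b - a) * (I / (b - a)) ^ 2 := by
    have : ∀ t, (|φ t| - I / (b - a)) ^ 2 =
        φ t ^ 2 - 2 * (I / (b - a)) * |φ t| + (I / (b - a)) ^ 2 := fun t => by
      rw [← sq_abs (φ t)]; ring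
    simp_rw [this]
    rw [intervalIntegral.integral_add (h2.sub (h1.const_mul _)) (by simp),
      intervalIntegral.integral_sub h2 (h1.const_mul _), intervalIntegral.integral_const_mul,
      intervalIntegral.integral_const, smul_eq_mul]
  rw [hexp] at hnn
  have := mul_nonneg hba.le hnn
  have e : (b - a) * ((∫ t in a..b, φ t ^ 2) - 2 * (I / (b - a)) * I +
      (b - a) * (I / (b - a)) ^ 2) = (b - a) * (∫ t in a..b, φ t ^ 2) - I ^ 2 := by
    field_simp
    ring
  linarith

/-- A function of small size at `a` and `b` whose second derivative has `L²` norm squared at most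
`E` is, between `a` and `b`, bounded up to the error of linear interpolation. -/
theorem abs_le_add_sqrt_of_endpoints {e : ℝ → ℝ} (he : ContDiffOn ℝ 2 e (Set.Icc (-1 : ℝ) 1))
    {a b x r E : ℝ} (ha : -1 ≤ a) (hab : a < b) (hb : b ≤ 1) (hx : x ∈ Set.Icc a b)
    (hra : |e a| ≤ r) (hrb : |e b| ≤ r)
    (hE : ∫ t in Set.Icc (-1 : ℝ) 1, iteratedDerivWithin 2 e (Set.Icc (-1 : ℝ) 1) t ^ 2 ≤ E) :
    |e x| ≤ r + Real.sqrt ((b - a) ^ 3 * E) := by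
  set S := Set.Icc (-1 : ℝ) 1 with hS
  set e1 := derivWithin e S
  set e2 := iteratedDerivWithin 2 e S
  have hsub : Set.Icc a b ⊆ S := Set.Icc_subset_Icc ha hb
  have hnhds : ∀ t ∈ Set.Ioo a b, S ∈ nhds t := fun t ht =>
    Icc_mem_nhds (by linarith [ht.1]) (by linarith [ht.2])
  have hd1 : ∀ t ∈ Set.Ioo a b, HasDerivAt e (e1 t) t := fun t ht =>
    (hasDerivWithinAt_of_contDiffOn_two he (hsub (Set.Ioo_subset_Icc_self ht))).hasDerivAt
      (hnhds t ht)
  have hd2 : ∀ t ∈ Set.Ioo a b, HasDerivAt e1 (e2 t) t := fun t ht =>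
    (hasDerivWithinAt_derivWithin_of_contDiffOn_two he
      (hsub (Set.Ioo_subset_Icc_self ht))).hasDerivAt (hnhds t ht)
  have hc0 : ContinuousOn e (Set.Icc a b) := he.continuousOn.mono hsub
  have hc1 : ContinuousOn e1 (Set.Icc a b) := fun t ht =>
    ((hasDerivWithinAt_derivWithin_of_contDiffOn_two he (hsub ht)).continuousWithinAt).mono hsub
  have hc2S : ContinuousOn e2 S := continuousOn_iteratedDerivWithin_two he
  have hc2 : ContinuousOn e2 (Set.Icc a b) := hc2S.mono hsub
  have hba : 0 < b - a := sub_pos.2 hab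
  have hint : ∫ t in a..b, e2 t ^ 2 ≤ E := by
    rw [intervalIntegral.integral_of_le hab.le]
    refine le_trans (setIntegral_mono_set ?_ ?_ ?_) hE
    · exact (hc2S.pow 2).integrableOn_compact isCompact_Icc
    · exact Filter.Eventually.of_forall fun t => sq_nonneg _
    · exact (Set.Ioc_subset_Icc_self.trans hsub).eventuallyLE
  set D := ∫ t in a..b, |e2 t|
  have hD0 : 0 ≤ D := intervalIntegral.integral_nonneg hab.le fun _ _ => abs_nonneg _
  have hDE : (b - a) * D ≤ Real.sqrt ((b - a) ^ 3 * E) := by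
    apply Real.le_sqrt_of_sq_le
    have h := sq_integral_le_mul_integral_sq hab hc2
    calc ((b - a) * D) ^ 2 = (b - a) ^ 2 * D ^ 2 := by ring
      _ ≤ (b - a) ^ 2 * ((b - a) * E) := by
          refine mul_le_mul_of_nonneg_left (h.trans ?_) (sq_nonneg _)
          exact mul_le_mul_of_nonneg_left hint hba.le
      _ = (b - a) ^ 3 * E := by ring
  have hosc : ∀ s ∈ Set.Icc a b, ∀ t ∈ Set.Icc a b, s ≤ t → |e1 t - e1 s| ≤ D := by
    intro s hs t ht hst
    have hst' : Set.Icc s t ⊆ Set.Icc a b := Set.Icc_subset_Icc hs.1 ht.2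
    have hc2' : ContinuousOn e2 (Set.uIcc s t) := by
      rw [Set.uIcc_of_le hst]; exact hc2.mono hst'
    rw [← intervalIntegral.integral_eq_sub_of_hasDerivAt_of_le hst (hc1.mono hst')
      (fun y hy => hd2 y ⟨hs.1.trans_lt hy.1, hy.2.trans_le ht.2⟩) hc2'.intervalIntegrable]
    refine (intervalIntegral.abs_integral_le_integral_abs hst).trans ?_
    refine intervalIntegral.integral_mono_interval hs.1 hst ht.2
      (Filter.Eventually.of_forall fun t => abs_nonneg _) ?_
    apply ContinuousOn.intervalIntegrable
    rw [Set.uIcc_of_le hab.le]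
    exact hc2.abs
  obtain ⟨c, hc, hce⟩ := exists_hasDerivAt_eq_slope e e1 hab hc0 hd1
  rcases hx.1.eq_or_lt with rfl | hax
  · exact hra.trans (le_add_of_nonneg_right (Real.sqrt_nonneg _))
  obtain ⟨d, hd, hde⟩ := exists_hasDerivAt_eq_slope e e1 hax
    (hc0.mono (Set.Icc_subset_Icc_right hx.2)) fun t ht => hd1 t ⟨ht.1, ht.2.trans_le hx.2⟩
  have hdab : d ∈ Set.Icc a b := ⟨hd.1.le, hd.2.le.trans hx.2⟩
  have hdc : |e1 d - e1 c| ≤ D := by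
    rcases le_total c d with h | h
    · exact hosc c (Set.Ioo_subset_Icc_self hc) d hdab h
    · rw [abs_sub_comm]
      exact hosc d hdab c (Set.Ioo_subset_Icc_self hc) h
  have hxa : 0 < x - a := sub_pos.2 hax
  have hex : e x = ((b - x) / (b - a)) * e a + ((x - a) / (b - a)) * e b +
      (e1 d - e1 c) * (x - a) := by
    rw [hde, hce]
    field_simp
    ring
  have hw1 : 0 ≤ (b - x) / (b - a) := div_nonneg (by linarith [hx.2]) hba.le
  have hw2 : 0 ≤ (x - a) / (b - a) := div_nonneg hxa.le hba.le
  have hw : (b - x) / (b - a) + (x - a) / (b - a) = 1 := by field_simp; ring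
  calc |e x| ≤ |(b - x) / (b - a) * e a| + |(x - a) / (b - a) * e b| +
        |(e1 d - e1 c) * (x - a)| := by
          rw [hex]; exact (abs_add_le _ _).trans (by gcongr; exact abs_add_le _ _)
    _ ≤ (b - x) / (b - a) * r + (x - a) / (b - a) * r + D * (b - a) := by
          rw [abs_mul, abs_mul, abs_mul, abs_of_nonneg hw1, abs_of_nonneg hw2, abs_of_pos hxa]
          gcongr
          exact hx.2
    _ = r + (b - a) * D := by rw [← add_mul, hw]; ring
    _ ≤ _ := by gcongr

theorem bernoulliMeasure_univ {p : ℝ} (hp : p ∈ Set.Ioo (0 : ℝ) 1) :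
    bernoulliMeasure p Set.univ = 1 := by
  simp [bernoulliMeasure, ← ENNReal.ofReal_add hp.1.le (sub_nonneg.2 hp.2.le)]

theorem bernoulliMeasure_true (p : ℝ) : bernoulliMeasure p {true} = ENNReal.ofReal p := by
  simp [bernoulliMeasure]

theorem isProbabilityMeasure_bernoulliMeasure {p : ℝ} (hp : p ∈ Set.Ioo (0 : ℝ) 1) :
    IsProbabilityMeasure (bernoulliMeasure p) := ⟨bernoulliMeasure_univ hp⟩

theorem isProbabilityMeasure_stragglerMeasure {p : ℝ} (hp : p ∈ Set.Ioo (0 : ℝ) 1) (N : ℕ) :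
    IsProbabilityMeasure (stragglerMeasure p N) := by
  have := isProbabilityMeasure_bernoulliMeasure hp
  unfold stragglerMeasure
  infer_instance

theorem stragglerMeasure_forall_true {p : ℝ} (hp : p ∈ Set.Ioo (0 : ℝ) 1) {N : ℕ}
    (S : Finset (Fin N)) :
    stragglerMeasure p N {ω | ∀ n ∈ S, ω n = true} = ENNReal.ofReal (p ^ S.card) := by
  have := isProbabilityMeasure_bernoulliMeasure hp
  have hset : {ω : Fin N → Bool | ∀ n ∈ S, ω n = true} =
      Set.univ.pi fun n => if n ∈ S then {true} else Set.univ := by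
    ext ω
    simp only [Set.mem_ofPred_eq, Set.mem_pi, Set.mem_univ, forall_true_left]
    refine forall_congr' fun n => ?_
    split_ifs with h <;> simp [h]
  have hn : ∀ n : Fin N, bernoulliMeasure p (if n ∈ S then {true} else Set.univ) =
      if n ∈ S then ENNReal.ofReal p else 1 := fun n => by
    split_ifs
    · exact bernoulliMeasure_true p
    · exact bernoulliMeasure_univ hp
  rw [hset, stragglerMeasure, Measure.pi_pi]
  simp_rw [hn]
  rw [Finset.prod_ite_mem, Finset.univ_inter, Finset.prod_const, ENNReal.ofReal_pow hp.1.le]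

theorem one_sub_le_stragglerMeasure {p δ : ℝ} (hp : p ∈ Set.Ioo (0 : ℝ) 1) {N K m : ℕ}
    {L R : Fin K → Finset (Fin N)} (hL : ∀ k, (L k).card = m) (hR : ∀ k, (R k).card = m)
    (hδ : 2 * K * p ^ m ≤ δ) {G : Set (Fin N → Bool)}
    (hG : ∀ ω, (∀ k, (∃ v ∈ L k, ω v = false) ∧ ∃ v ∈ R k, ω v = false) → ω ∈ G) :
    ENNReal.ofReal (1 - δ) ≤ stragglerMeasure p N G := by
  have := isProbabilityMeasure_stragglerMeasure hp N
  have hcompl : stragglerMeasure p N Gᶜ ≤ ENNReal.ofReal δ := by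
    have hsub : Gᶜ ⊆ ⋃ k, ({ω : Fin N → Bool | ∀ n ∈ L k, ω n = true} ∪
        {ω | ∀ n ∈ R k, ω n = true}) := by
      intro ω hω
      by_contra h
      refine hω (hG ω fun k => ?_)
      have hk : ¬((∀ n ∈ L k, ω n = true) ∨ ∀ n ∈ R k, ω n = true) :=
        fun hk => h (Set.mem_iUnion.2 ⟨k, hk⟩)
      simpa [not_or] using hk
    calc stragglerMeasure p N Gᶜ
        ≤ ∑ k, stragglerMeasure p N ({ω : Fin N → Bool | ∀ n ∈ L k, ω n = true} ∪
            {ω | ∀ n ∈ R k, ω n = true}) :=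
          (measure_mono hsub).trans (measure_iUnion_fintype_le _ _)
      _ ≤ ∑ _k : Fin K, (ENNReal.ofReal (p ^ m) + ENNReal.ofReal (p ^ m)) := by
          refine Finset.sum_le_sum fun k _ => (measure_union_le _ _).trans ?_
          rw [stragglerMeasure_forall_true hp, stragglerMeasure_forall_true hp, hL, hR]
      _ = ENNReal.ofReal (2 * K * p ^ m) := by
          have hpm : 0 ≤ p ^ m := pow_nonneg hp.1.le m
          rw [← ENNReal.ofReal_add hpm hpm, Finset.sum_const, Finset.card_univ, Fintype.card_fin,
            ← ENNReal.ofReal_nsmul, nsmul_eq_mul]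
          congr 1
          ring
      _ ≤ ENNReal.ofReal δ := ENNReal.ofReal_le_ofReal hδ
  have hmeas : MeasurableSet Gᶜ := (Set.toFinite _).measurableSet
  have hδ0 : 0 ≤ δ := le_trans (by have := hp.1; positivity) hδ
  rw [← compl_compl G, prob_compl_eq_one_sub hmeas, ENNReal.ofReal_sub _ hδ0, ENNReal.ofReal_one]
  exact tsub_le_tsub_left hcompl 1

theorem extNodes_zero {N : ℕ} (β : Fin N → ℝ) : extNodes β 0 = -1 := by simp [extNodes]

theorem extNodes_last {N : ℕ} (β : Fin N → ℝ) : extNodes β (N + 1) = 1 := by simp [extNodes]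

theorem extNodes_succ {N : ℕ} (β : Fin N → ℝ) (n : Fin N) : extNodes β (n + 1) = β n := by
  have : 1 ≤ (n : ℕ) + 1 ∧ (n : ℕ) + 1 ≤ N := ⟨by omega, n.2⟩
  simp [extNodes, this]

theorem extNodes_lt_succ {N : ℕ} {β : Fin N → ℝ} (hβ : StrictMono β)
    (hβ1 : ∀ n, β n ∈ Set.Ioo (-1 : ℝ) 1) {n : ℕ} (hn : n ≤ N) :
    extNodes β n < extNodes β (n + 1) := by
  rcases n with _ | n
  · rw [extNodes_zero]
    rcases N with _ | N
    · rw [extNodes_last]; norm_num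
    · exact (hβ1 ⟨0, by omega⟩).1.trans_eq (extNodes_succ β ⟨0, by omega⟩).symm
  · rw [extNodes_succ β ⟨n, hn⟩]
    rcases hn.eq_or_lt with h | h
    · rw [h, extNodes_last]; exact (hβ1 _).2
    · rw [extNodes_succ β ⟨n + 1, h⟩]
      exact hβ (Fin.mk_lt_mk.2 n.lt_succ_self)

theorem extNodes_le_add {N : ℕ} {β : Fin N → ℝ} (hβ : StrictMono β)
    (hβ1 : ∀ n, β n ∈ Set.Ioo (-1 : ℝ) 1) (j i : ℕ) (hij : j + i ≤ N + 1) :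
    extNodes β j ≤ extNodes β (j + i) := by
  induction i with
  | zero => rfl
  | succ i ih => exact (ih (by omega)).trans (extNodes_lt_succ hβ hβ1 (n := j + i) (by omega)).le

theorem extNodes_add_le {N : ℕ} {β : Fin N → ℝ} {Δ : ℝ}
    (hΔ : ∀ n ≤ N, extNodes β (n + 1) - extNodes β n ≤ Δ) (j i : ℕ) (hij : j + i ≤ N + 1) :
    extNodes β (j + i) ≤ extNodes β j + i * Δ := by
  induction i with
  | zero => simp
  | succ i ih =>
    have h1 := ih (by omega)
    have h2 := hΔ (j + i) (by omega)
    rw [← add_assoc]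
    push_cast
    linarith

theorem sub_le_dMax {N : ℕ} (β : Fin N → ℝ) {n : ℕ} (hn : n ≤ N) :
    extNodes β (n + 1) - extNodes β n ≤ dMax β :=
  le_csSup ((Set.finite_Iic N).image _).bddAbove (Set.mem_image_of_mem _ hn)

theorem dMin_le_sub {N : ℕ} (β : Fin N → ℝ) {n : ℕ} (hn : n ∈ Set.Icc 1 (N - 1)) :
    dMin β ≤ extNodes β (n + 1) - extNodes β n :=
  csInf_le ((Set.finite_Icc 1 (N - 1)).image _).bddBelow (Set.mem_image_of_mem _ hn)

theorem dMin_pos {N : ℕ} (hN : 2 ≤ N) {β : Fin N → ℝ} (hβ : StrictMono β)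
    (hβ1 : ∀ n, β n ∈ Set.Ioo (-1 : ℝ) 1) : 0 < dMin β := by
  obtain ⟨n, hn, hne⟩ := Set.Nonempty.csInf_mem
    (s := (fun n => extNodes β (n + 1) - extNodes β n) '' Set.Icc 1 (N - 1))
    ((Set.nonempty_Icc.2 (by omega)).image _) ((Set.finite_Icc 1 (N - 1)).image _)
  rw [dMin, ← hne]
  exact sub_pos.2 (extNodes_lt_succ hβ hβ1 (hn.2.trans (Nat.sub_le N 1)))

theorem mul_dMin_le_two {N : ℕ} (hN : 2 ≤ N) {β : Fin N → ℝ}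
    (hβ1 : ∀ n, β n ∈ Set.Ioo (-1 : ℝ) 1) : ((N : ℝ) - 1) * dMin β ≤ 2 := by
  have key : ∀ i, i ≤ N - 1 → extNodes β 1 + i * dMin β ≤ extNodes β (1 + i) := by
    intro i
    induction i with
    | zero => simp
    | succ i ih =>
      intro hi
      have h1 := ih (by omega)
      have h2 := dMin_le_sub β (n := 1 + i) ⟨by omega, by omega⟩
      rw [← add_assoc]
      push_cast
      linarith
  have h := key (N - 1) le_rfl
  have hl := extNodes_succ β ⟨0, by omega⟩
  have hr := extNodes_succ β ⟨N - 1, by omega⟩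
  simp only [zero_add] at hl
  rw [add_comm 1, hl, hr, Nat.cast_sub (by omega), Nat.cast_one] at h
  linarith [(hβ1 ⟨0, by omega⟩).1, (hβ1 ⟨N - 1, by omega⟩).2]

theorem dMax_le_div {N : ℕ} (hN : 2 ≤ N) {β : Fin N → ℝ} (hβ : StrictMono β)
    (hβ1 : ∀ n, β n ∈ Set.Ioo (-1 : ℝ) 1) {B : ℝ} (hB : 0 < B)
    (hΔ : dMax β / dMin β ≤ B) : dMax β ≤ 4 * B / N := by
  have hN' : (2 : ℝ) ≤ N := by exact_mod_cast hN
  have h1 := mul_dMin_le_two hN hβ1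
  have h0 := dMin_pos hN hβ hβ1
  rw [div_le_iff₀ h0] at hΔ
  rw [le_div_iff₀ (by linarith)]
  have h2 : (N : ℝ) * dMin β ≤ 4 := by nlinarith
  calc dMax β * N ≤ B * dMin β * N := by gcongr
    _ = B * (N * dMin β) := by ring
    _ ≤ B * 4 := by gcongr
    _ = 4 * B := by ring

theorem exists_windows {N : ℕ} {β : Fin N → ℝ} (hβ : StrictMono β)
    (hβ1 : ∀ n, β n ∈ Set.Ioo (-1 : ℝ) 1) {Δ : ℝ} (hΔ0 : 0 ≤ Δ)
    (hΔ : ∀ n ≤ N, extNodes β (n + 1) - extNodes β n ≤ Δ) {x : ℝ} {m : ℕ}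
    (hx1 : m * Δ ≤ 1 + x) (hx2 : m * Δ < 1 - x) :
    ∃ L R : Finset (Fin N), L.card = m ∧ R.card = m ∧
      (∀ n ∈ L, x - m * Δ ≤ β n ∧ β n ≤ x) ∧ ∀ n ∈ R, x < β n ∧ β n ≤ x + m * Δ := by
  have hmΔ : 0 ≤ m * Δ := by positivity
  have hmono : ∀ i ≤ m, (i : ℝ) * Δ ≤ m * Δ := fun i hi => by gcongr
  obtain ⟨j, hjN, hj1, hj2⟩ : ∃ j ≤ N, extNodes β j ≤ x ∧ x < extNodes β (j + 1) := by
    classical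
    have h0 : extNodes β 0 ≤ x := by rw [extNodes_zero]; linarith
    refine ⟨Nat.findGreatest (fun j => extNodes β j ≤ x) N, Nat.findGreatest_le N,
      Nat.findGreatest_spec (P := fun j => extNodes β j ≤ x) (Nat.zero_le N) h0, ?_⟩
    rcases (Nat.findGreatest_le (P := fun j => extNodes β j ≤ x) N).eq_or_lt with h | h
    · rw [h, extNodes_last]; linarith
    · exact not_le.1 (Nat.findGreatest_is_greatest (P := fun j => extNodes β j ≤ x)
        (Nat.lt_succ_self _) h)
  have hmj : m ≤ j := by
    by_contra! h
    have h1 := extNodes_add_le hΔ 0 (j + 1) (by omega)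
    rw [zero_add, extNodes_zero] at h1
    linarith [hmono (j + 1) h]
  have hjm : j + m ≤ N := by
    by_contra! h
    have h1 := extNodes_add_le hΔ j (N + 1 - j) (by omega)
    rw [show j + (N + 1 - j) = N + 1 by omega, extNodes_last] at h1
    linarith [hmono (N + 1 - j) (by omega)]
  refine ⟨Finset.univ.image fun i : Fin m => ⟨j - 1 - i, by omega⟩,
    Finset.univ.image fun i : Fin m => ⟨j + i, by omega⟩, ?_, ?_, ?_, ?_⟩
  · rw [Finset.card_image_of_injective, Finset.card_univ, Fintype.card_fin]
    intro a b hab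
    simp only [Fin.mk.injEq] at hab
    omega
  · rw [Finset.card_image_of_injective, Finset.card_univ, Fintype.card_fin]
    intro a b hab
    simp only [Fin.mk.injEq] at hab
    omega
  · intro n hn
    obtain ⟨i, -, rfl⟩ := Finset.mem_image.1 hn
    have hi := i.2
    rw [← extNodes_succ β]
    simp only
    have h1 := extNodes_add_le hΔ (j - 1 - i + 1) (i + 1) (by omega)
    have h2 := extNodes_le_add hβ hβ1 (j - 1 - i + 1) i (by omega)
    rw [show j - 1 - (i : ℕ) + 1 + (i + 1) = j + 1 by omega] at h1
    rw [show j - 1 - (i : ℕ) + 1 + i = j by omega] at h2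
    exact ⟨by linarith [hmono (i + 1) (by omega)], by linarith⟩
  · intro n hn
    obtain ⟨i, -, rfl⟩ := Finset.mem_image.1 hn
    have hi := i.2
    rw [← extNodes_succ β]
    simp only
    have h1 := extNodes_add_le hΔ j (i + 1) (by omega)
    have h2 := extNodes_le_add hβ hβ1 (j + 1) i (by omega)
    rw [show j + 1 + (i : ℕ) = j + i + 1 by omega] at h2
    rw [← add_assoc] at h1
    exact ⟨by linarith, by linarith [hmono (i + 1) (by omega)]⟩

theorem exists_smoothingSpline_error_bound {ν η : ℝ} (hν : 0 < ν) (hη : 0 < η) {f : ℝ → ℝ}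
    (hLip : ∀ a b : ℝ, |f a - f b| ≤ ν * |a - b|)
    (hf1 : ∀ t, DifferentiableAt ℝ f t) (hf2 : ∀ t, DifferentiableAt ℝ (deriv f) t)
    (hfη : ∀ t, |deriv (deriv f) t| ≤ η)
    {uenc : ℝ → ℝ} (huenc : ContDiffOn ℝ 2 uenc (Set.Icc (-1 : ℝ) 1)) :
    ∃ E : ℝ, 0 < E ∧ ∀ {N : ℕ} {β : Fin N → ℝ}, (∀ n, β n ∈ Set.Ioo (-1 : ℝ) 1) →
      ∀ {lam : ℝ}, 0 < lam → ∀ {F : Finset (Fin N)} {u : ℝ → ℝ},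
        IsSmoothingSpline F β (fun v => f (uenc (β v))) lam u →
      ∀ a ∈ F, ∀ b ∈ F, β a < β b → ∀ x ∈ Set.Icc (β a) (β b),
        (u x - f (uenc x)) ^ 2 ≤ E * (N * lam + (β b - β a) ^ 3) := by
  set S := Set.Icc (-1 : ℝ) 1 with hS
  obtain ⟨A₁, hA₁⟩ := isCompact_Icc.exists_bound_of_continuousOn
    (f := derivWithin uenc S) fun t ht =>
      (hasDerivWithinAt_derivWithin_of_contDiffOn_two huenc ht).continuousWithinAt
  obtain ⟨A₂, hA₂⟩ := isCompact_Icc.exists_bound_of_continuousOn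
    (continuousOn_iteratedDerivWithin_two huenc)
  set M := η * A₁ ^ 2 + ν * A₂ with hM
  refine ⟨3 * ((1 + 2 * M ^ 2) + 4 + (2 * (1 + 2 * M ^ 2) + 4 * M ^ 2)), by positivity, ?_⟩
  intro N β hβ1 lam hlam F u hu a ha b hb hab x hx
  obtain ⟨g, hg, hgf, hg1, hg2⟩ :=
    exists_contDiff_two_approx hν hLip hf1 hf2 hfη (Real.sqrt_pos.2 hlam)
  have hw : ContDiffOn ℝ 2 (g ∘ uenc) S := hg.comp_contDiffOn huenc
  have hw2 : ∀ t ∈ S, iteratedDerivWithin 2 (g ∘ uenc) S t ^ 2 ≤ M ^ 2 := by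
    intro t ht
    rw [← sq_abs]
    refine pow_le_pow_left₀ (abs_nonneg _) ?_ 2
    rw [iteratedDerivWithin_two_comp hg huenc ht]
    refine (abs_add_le _ _).trans ?_
    rw [abs_mul, abs_mul, abs_pow, hM]
    have h1 := hA₁ t ht
    have h2 := hA₂ t ht
    rw [Real.norm_eq_abs] at h1 h2
    have h3 := hg1 (uenc t)
    have h4 := hg2 (uenc t)
    gcongr
  have hint : ∀ {v : ℝ → ℝ}, ContDiffOn ℝ 2 v S →
      IntegrableOn (fun t => iteratedDerivWithin 2 v S t ^ 2) S := fun hv =>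
    ((continuousOn_iteratedDerivWithin_two hv).pow 2).integrableOn_compact isCompact_Icc
  have hwint : ∫ t in S, iteratedDerivWithin 2 (g ∘ uenc) S t ^ 2 ≤ 2 * M ^ 2 := by
    refine (setIntegral_mono_on (hint hw) (by simp [hS]) measurableSet_Icc hw2).trans_eq ?_
    rw [setIntegral_const, hS, Real.volume_real_Icc_of_le (by norm_num), smul_eq_mul]
    norm_num
  have hcard : 0 < (F.card : ℝ) := by exact_mod_cast Finset.card_pos.2 ⟨a, ha⟩
  have hcardN : (F.card : ℝ) ≤ N := by
    exact_mod_cast (Finset.card_le_univ F).trans_eq (Fintype.card_fin N)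
  have hN1 : (1 : ℝ) ≤ N := le_trans (by exact_mod_cast Finset.card_pos.2 ⟨a, ha⟩) hcardN
  have hJw : splineLoss F β (fun v => f (uenc (β v))) lam (g ∘ uenc) ≤
      lam * (1 + 2 * M ^ 2) := by
    have h1 : ∑ v ∈ F, ((g ∘ uenc) (β v) - f (uenc (β v))) ^ 2 ≤ F.card * lam := by
      rw [← nsmul_eq_mul]
      refine Finset.sum_le_card_nsmul _ _ _ fun v _ => ?_
      rw [← sq_abs, ← Real.sq_sqrt hlam.le]
      exact pow_le_pow_left₀ (abs_nonneg _) (hgf _) 2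
    unfold splineLoss
    calc _ ≤ 1 / (F.card : ℝ) * (F.card * lam) + lam * (2 * M ^ 2) := by gcongr
      _ = _ := by field_simp
  have hJu := (hu.2 _ ⟨hw, hint hw⟩).trans hJw
  have huC := hu.1.1
  unfold splineLoss at hJu
  have hsum0 : 0 ≤ ∑ v ∈ F, (u (β v) - f (uenc (β v))) ^ 2 :=
    Finset.sum_nonneg fun _ _ => sq_nonneg _
  have huint0 : 0 ≤ ∫ t in S, iteratedDerivWithin 2 u S t ^ 2 :=
    integral_nonneg fun _ => sq_nonneg _
  have huint : ∫ t in S, iteratedDerivWithin 2 u S t ^ 2 ≤ 1 + 2 * M ^ 2 := by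
    refine le_of_mul_le_mul_left (le_trans ?_ hJu) hlam
    exact le_add_of_nonneg_left (by positivity)
  have hsum : ∑ v ∈ F, (u (β v) - f (uenc (β v))) ^ 2 ≤ N * lam * (1 + 2 * M ^ 2) := by
    have h1 : 1 / (F.card : ℝ) * ∑ v ∈ F, (u (β v) - f (uenc (β v))) ^ 2 ≤
        lam * (1 + 2 * M ^ 2) :=
      le_trans (le_add_of_nonneg_right (by positivity)) hJu
    rw [one_div, inv_mul_le_iff₀ hcard] at h1
    refine h1.trans ?_
    rw [mul_assoc]
    gcongr
  set P := Real.sqrt (N * lam * (1 + 2 * M ^ 2))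
  set Q := Real.sqrt lam
  have hnode : ∀ v ∈ F, |(u - g ∘ uenc) (β v)| ≤ P + Q := by
    intro v hv
    have h1 : |u (β v) - f (uenc (β v))| ≤ P := by
      refine Real.abs_le_sqrt (le_trans ?_ hsum)
      exact Finset.single_le_sum (f := fun v => (u (β v) - f (uenc (β v))) ^ 2)
        (fun _ _ => sq_nonneg _) hv
    have h2 := hgf (uenc (β v))
    rw [abs_sub_comm] at h2
    calc |(u - g ∘ uenc) (β v)|
        = |(u (β v) - f (uenc (β v))) + (f (uenc (β v)) - g (uenc (β v)))| := by simp
      _ ≤ P + Q := (abs_add_le _ _).trans (add_le_add h1 h2)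
  have heint : ∫ t in S, iteratedDerivWithin 2 (u - g ∘ uenc) S t ^ 2 ≤
      2 * (1 + 2 * M ^ 2) + 4 * M ^ 2 := by
    calc ∫ t in S, iteratedDerivWithin 2 (u - g ∘ uenc) S t ^ 2
        ≤ ∫ t in S, (2 * iteratedDerivWithin 2 u S t ^ 2 +
            2 * iteratedDerivWithin 2 (g ∘ uenc) S t ^ 2) := by
          refine setIntegral_mono_on (hint (huC.sub hw))
            (((hint huC).const_mul 2).add ((hint hw).const_mul 2)) measurableSet_Icc fun t ht => ?_
          rw [iteratedDerivWithin_sub ht uniqueDiffOn_Icc_neg_one_one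
            (by rw [Nat.cast_ofNat]; exact huC t ht) (by rw [Nat.cast_ofNat]; exact hw t ht)]
          nlinarith [sq_nonneg (iteratedDerivWithin 2 u S t +
            iteratedDerivWithin 2 (g ∘ uenc) S t)]
      _ = 2 * (∫ t in S, iteratedDerivWithin 2 u S t ^ 2) +
            2 * ∫ t in S, iteratedDerivWithin 2 (g ∘ uenc) S t ^ 2 := by
          rw [integral_add ((hint huC).const_mul 2) ((hint hw).const_mul 2),
            integral_const_mul, integral_const_mul]
      _ ≤ _ := by linarith
  have hex := abs_le_add_sqrt_of_endpoints (huC.sub hw) (hβ1 a).1.le hab (hβ1 b).2.le hx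
    (hnode a ha) (hnode b hb) heint
  set h3 := (β b - β a) ^ 3
  have hh30 : 0 ≤ h3 := pow_nonneg (sub_nonneg.2 hab.le) 3
  set E₁ := 2 * (1 + 2 * M ^ 2) + 4 * M ^ 2
  set R := Real.sqrt (h3 * E₁)
  have hfin : |u x - f (uenc x)| ≤ P + 2 * Q + R := by
    calc |u x - f (uenc x)| = |(u - g ∘ uenc) x + (g (uenc x) - f (uenc x))| := by simp
      _ ≤ (P + Q + R) + Q := (abs_add_le _ _).trans (add_le_add hex (hgf _))
      _ = _ := by ring
  have hE₁0 : 0 ≤ E₁ := by positivity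
  have hP2 : P ^ 2 = N * lam * (1 + 2 * M ^ 2) := Real.sq_sqrt (by positivity)
  have hQ2 : Q ^ 2 = lam := Real.sq_sqrt hlam.le
  have hR2 : R ^ 2 = h3 * E₁ := Real.sq_sqrt (by positivity)
  have hlamN : lam ≤ N * lam := le_mul_of_one_le_left hlam.le hN1
  calc (u x - f (uenc x)) ^ 2 ≤ (P + 2 * Q + R) ^ 2 := by
        rw [← sq_abs]; exact pow_le_pow_left₀ (abs_nonneg _) hfin 2
    _ ≤ 3 * (P ^ 2 + 4 * Q ^ 2 + R ^ 2) := by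
        nlinarith [sq_nonneg (P - 2 * Q), sq_nonneg (P - R), sq_nonneg (2 * Q - R)]
    _ = 3 * (N * lam * (1 + 2 * M ^ 2) + 4 * lam + h3 * E₁) := by rw [hP2, hQ2, hR2]
    _ ≤ 3 * (N * lam * (1 + 2 * M ^ 2) + 4 * (N * lam) + h3 * E₁ +
          (N * lam * E₁ + h3 * ((1 + 2 * M ^ 2) + 4))) := by
        have : 0 ≤ N * lam * E₁ + h3 * ((1 + 2 * M ^ 2) + 4) := by positivity
        linarith
    _ = _ := by ring

/-- **Corollary 1, LeTCC part:** under probabilistic stragglers the average approximation error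
of `LeTCC` converges to zero with high probability at rate `O(log³_{1/p}(N)·N^{−3})`. -/
theorem letcc_rate_probabilistic_stragglers
    (p : ℝ) (hp : p ∈ Set.Ioo (0 : ℝ) 1) (B δ ν η : ℝ)
    (hB : 0 < B) (hδ : δ ∈ Set.Ioo (0 : ℝ) 1) (hν : 0 < ν) (hη : 0 < η)
    (f : ℝ → ℝ)
    (hLip : ∀ a b : ℝ, |f a - f b| ≤ ν * |a - b|)
    (hf1 : ∀ t, DifferentiableAt ℝ f t)
    (hf2 : ∀ t, DifferentiableAt ℝ (deriv f) t)
    (hfη : ∀ t, |deriv (deriv f) t| ≤ η)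
    (uenc : ℝ → ℝ) (huenc : ContDiffOn ℝ 2 uenc (Set.Icc (-1 : ℝ) 1))
    (K : ℕ) (hK : 0 < K)
    (α : Fin K → ℝ) (hα : StrictMono α) (hα1 : ∀ k, α k ∈ Set.Ioo (-1 : ℝ) 1)
    (x : Fin K → ℝ) (hinterp : ∀ k, uenc (α k) = x k) :
    ∃ C : ℝ, 0 < C ∧ ∃ n0 : ℕ, ∀ N : ℕ, n0 < N →
      ∀ β : Fin N → ℝ, StrictMono β → (∀ n, β n ∈ Set.Ioo (-1 : ℝ) 1) →
        dMax β / dMin β ≤ B →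
      ∀ lam : ℝ, 0 < lam → lam ≤ ((N : ℝ) ^ 4)⁻¹ →
      ∀ udec : (Fin N → Bool) → ℝ → ℝ,
        (∀ ω, (nonStragglers ω).Nonempty →
          IsSmoothingSpline (nonStragglers ω) β (fun v => f (uenc (β v))) lam (udec ω)) →
      stragglerMeasure p N
        {ω | (nonStragglers ω).Nonempty ∧
          (1 / (K : ℝ)) * ∑ k, (udec ω (α k) - f (x k)) ^ 2 ≤
            C * (Real.logb (1 / p) N) ^ 3 / (N : ℝ) ^ 3} ≥
        ENNReal.ofReal (1 - δ) := by
  obtain ⟨E, hE, hbound⟩ := exists_smoothingSpline_error_bound hν hη hLip hf1 hf2 hfη huenc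
  have hKR : (0 : ℝ) < K := by exact_mod_cast hK
  obtain ⟨m, hm⟩ := exists_pow_lt_of_lt_one (div_pos hδ.1 (by positivity : (0 : ℝ) < 2 * K)) hp.2
  rw [lt_div_iff₀ (by positivity), mul_comm] at hm
  obtain ⟨d, hd, hαd⟩ : ∃ d > 0, ∀ k, d < 1 + α k ∧ d < 1 - α k := by
    have h : ∀ᶠ d in nhdsWithin (0 : ℝ) (Set.Ioi 0), ∀ k, d < 1 + α k ∧ d < 1 - α k := by
      refine Filter.eventually_all.2 fun k => Filter.Eventually.filter_mono nhdsWithin_le_nhds ?_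
      exact (eventually_lt_nhds (by linarith [(hα1 k).1])).and
        (eventually_lt_nhds (by linarith [(hα1 k).2]))
    obtain ⟨d, hd1, hd2⟩ := (h.and self_mem_nhdsWithin).exists
    exact ⟨d, hd2, hd1⟩
  obtain ⟨n₁, hn₁⟩ := exists_nat_gt (m * (4 * B) / d)
  obtain ⟨n₂, hn₂⟩ := exists_nat_gt (1 / p)
  refine ⟨E * (1 + (2 * m * (4 * B)) ^ 3), by positivity, max 2 (max n₁ n₂), ?_⟩
  intro N hN β hβ hβ1 hΔ lam hlam hlamN udec hudec
  obtain ⟨hN2, hN₁, hN₂⟩ : 2 ≤ N ∧ n₁ < N ∧ n₂ < N := by omega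
  have hNR : (0 : ℝ) < N := by exact_mod_cast (by omega : 0 < N)
  have hN₁' : m * (4 * B) / d < N := hn₁.trans (by exact_mod_cast hN₁)
  have hN₂' : 1 / p < N := hn₂.trans (by exact_mod_cast hN₂)
  set Δ := 4 * B / N with hΔdef
  have hΔ0 : 0 ≤ Δ := by positivity
  have hmΔ : m * Δ < d := by
    rw [div_lt_iff₀ hd] at hN₁'
    rw [hΔdef, ← mul_div_assoc, div_lt_iff₀ hNR]
    linarith
  have hgap : ∀ n ≤ N, extNodes β (n + 1) - extNodes β n ≤ Δ := fun n hn =>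
    (sub_le_dMax β hn).trans (dMax_le_div hN2 hβ hβ1 hB hΔ)
  choose L R hLc hRc hL hR using fun k => exists_windows hβ hβ1 hΔ0 hgap (x := α k) (m := m)
    (by linarith [(hαd k).1]) (by linarith [(hαd k).2])
  refine one_sub_le_stragglerMeasure hp hLc hRc hm.le fun ω hω => ?_
  have hmem : ∀ v, ω v = false → v ∈ nonStragglers ω := fun v hv => by simp [nonStragglers, hv]
  obtain ⟨v₀, -, hv₀⟩ := (hω ⟨0, hK⟩).1
  have hne : (nonStragglers ω).Nonempty := ⟨v₀, hmem v₀ hv₀⟩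
  refine ⟨hne, ?_⟩
  have hlog : 1 ≤ Real.logb (1 / p) N := by
    rw [Real.le_logb_iff_rpow_le (one_lt_one_div hp.1 hp.2) hNR, Real.rpow_one]
    exact hN₂'.le
  have hterm : ∀ k, (udec ω (α k) - f (x k)) ^ 2 ≤
      E * (1 + (2 * m * (4 * B)) ^ 3) / (N : ℝ) ^ 3 := by
    intro k
    obtain ⟨⟨a, ha, hωa⟩, b, hb, hωb⟩ := hω k
    have ha' := hL k a ha
    have hb' := hR k b hb
    have h := hbound hβ1 hlam (hudec ω hne) a (hmem a hωa) b (hmem b hωb)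
      (ha'.2.trans_lt hb'.1) (α k) ⟨ha'.2, hb'.1.le⟩
    rw [hinterp k] at h
    refine h.trans ?_
    rw [mul_div_assoc, add_div]
    have h1 : N * lam ≤ 1 / (N : ℝ) ^ 3 := by
      calc N * lam ≤ N * ((N : ℝ) ^ 4)⁻¹ := by gcongr
        _ = 1 / (N : ℝ) ^ 3 := by field_simp
    have h2 : (β b - β a) ^ 3 ≤ (2 * m * (4 * B)) ^ 3 / (N : ℝ) ^ 3 := by
      rw [← div_pow]
      refine pow_le_pow_left₀ (by linarith) ?_ 3
      calc β b - β a ≤ 2 * (m * Δ) := by linarith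
        _ = 2 * m * (4 * B) / N := by rw [hΔdef]; ring
    gcongr
  calc (1 / (K : ℝ)) * ∑ k, (udec ω (α k) - f (x k)) ^ 2
      ≤ (1 / (K : ℝ)) * ∑ _k : Fin K, E * (1 + (2 * m * (4 * B)) ^ 3) / (N : ℝ) ^ 3 := by
        gcongr with k
        exact hterm k
    _ = E * (1 + (2 * m * (4 * B)) ^ 3) * 1 / (N : ℝ) ^ 3 := by
        rw [Finset.sum_const, Finset.card_univ, Fintype.card_fin, nsmul_eq_mul]
        field_simp
    _ ≤ _ := by
        gcongr
        exact one_le_pow₀ hlog
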